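/- Let G be an almost Moore digraph of degree d > 1 and diameter k > 1 and let α > 1 be an integer. Then the subdigraph H_α has diameter at most k: for any two vertices u, v of H_α there is a directed walk of length at most k from u to v using only vertices of H_α. -/

import Mathlib

/-- `IsWalkFrom A u v l` : the list `u :: l` is a directed walk from `u` to `v`
along the adjacency relation `A`; the length of the walk is `l.length`. -/
def IsWalkFrom {V : Type} (A : V → V → Prop) (u v : V) (l : List V) : Prop :=
  List.Chain A u l ∧ (u :: l).getLast (List.cons_ne_nil u l) = v

/-- An almost Moore digraph (a `(d,k)`-digraph): a diregular digraph of degree `d > 1`,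
diameter `k > 1` and order `d + d² + ⋯ + d^k`, together with its repeat permutation `rep`:
for every vertex `v`, every vertex `w ≠ rep v` is reached from `v` by exactly one walk of
length at most `k`, while `rep v` is reached by exactly two such walks, at least one of
which has length `k`.  The map `rep` is an automorphism of the digraph. -/
structure AlmostMooreDigraph (d k : ℕ) where
  hd : 1 < d
  hk : 1 < k
  V : Type
  [fintypeV : Fintype V]
  [decEqV : DecidableEq V]
  Adj : V → V → Prop
  [adjDec : DecidableRel Adj]
  loopless : ∀ v, ¬ Adj v v
  out_deg : ∀ v, {w | Adj v w}.ncard = d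
  in_deg : ∀ v, {w | Adj w v}.ncard = d
  reach : ∀ u v, ∃ l, IsWalkFrom Adj u v l ∧ l.length ≤ k
  diam : ∃ u v, ∀ l, IsWalkFrom Adj u v l → k ≤ l.length
  card_eq : Fintype.card V = ∑ i ∈ Finset.range k, d ^ (i + 1)
  rep : V → V
  rep_spec : ∀ v w, w ≠ rep v → ∃! l, IsWalkFrom Adj v w l ∧ l.length ≤ k
  rep_two : ∀ v, ∃ l₁ l₂, l₁ ≠ l₂ ∧
      IsWalkFrom Adj v (rep v) l₁ ∧ l₁.length ≤ k ∧
      IsWalkFrom Adj v (rep v) l₂ ∧ l₂.length ≤ k ∧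
      (l₁.length = k ∨ l₂.length = k) ∧
      (∀ l, IsWalkFrom Adj v (rep v) l → l.length ≤ k → l = l₁ ∨ l = l₂)
  rep_bijective : Function.Bijective rep
  rep_adj : ∀ u v, Adj u v ↔ Adj (rep u) (rep v)

attribute [instance] AlmostMooreDigraph.fintypeV AlmostMooreDigraph.decEqV
  AlmostMooreDigraph.adjDec

/-- `ordRep M v` : the smallest `t ≥ 1` with `rep^t v = v`. -/
noncomputable def ordRep {d k : ℕ} (M : AlmostMooreDigraph d k) (v : M.V) : ℕ :=
  sInf {t | 0 < t ∧ M.rep^[t] v = v}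

/-- The vertex set of the subdigraph `H_α`: vertices whose order under the repeat
permutation divides `2^t * α` for some `t ≥ 0`. -/
def Hset {d k : ℕ} (M : AlmostMooreDigraph d k) (α : ℕ) : Set M.V :=
  {v | ∃ t : ℕ, ordRep M v ∣ 2 ^ t * α}

/-- The image of a walk under a map preserving adjacency is a walk. -/
theorem IsWalkFrom.map {V : Type} {A : V → V → Prop} {f : V → V}
    (hf : ∀ a b, A a b → A (f a) (f b)) {u v : V} {l : List V} (h : IsWalkFrom A u v l) :
    IsWalkFrom A (f u) (f v) (l.map f) := by
  obtain ⟨hchain, hlast⟩ := h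
  refine ⟨?_, ?_⟩
  · exact (List.isChain_cons_map f).2 (List.IsChain.imp hf hchain)
  · simp only [← List.map_cons, List.getLast_map, hlast]

theorem ordRep_eq_minimalPeriod {d k : ℕ} (M : AlmostMooreDigraph d k) (v : M.V) :
    ordRep M v = Function.minimalPeriod M.rep v := by
  have hper : v ∈ Function.periodicPts M.rep := M.rep_bijective.injective.mem_periodicPts v
  refine IsLeast.csInf_eq ⟨⟨Function.minimalPeriod_pos_of_mem_periodicPts hper,
    Function.iterate_minimalPeriod⟩, ?_⟩
  rintro t ⟨ht, hfix⟩
  exact Function.IsPeriodicPt.minimalPeriod_le ht hfix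

theorem mem_Hset_iff {d k : ℕ} (M : AlmostMooreDigraph d k) (α : ℕ) (v : M.V) :
    v ∈ Hset M α ↔ ∃ t : ℕ, M.rep^[2 ^ t * α] v = v := by
  simp only [Hset, Set.mem_ofPred_eq, ordRep_eq_minimalPeriod,
    ← Function.isPeriodicPt_iff_minimalPeriod_dvd]
  rfl

theorem iterate_rep_adj {d k : ℕ} (M : AlmostMooreDigraph d k) (n : ℕ) (u v : M.V)
    (h : M.Adj u v) : M.Adj (M.rep^[n] u) (M.rep^[n] v) := by
  induction n with
  | zero => exact h
  | succ n ih =>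
    rw [Function.iterate_succ_apply', Function.iterate_succ_apply']
    exact (M.rep_adj _ _).1 ih

/-- If `rep^[n]` fixes `u` and `v`, then some walk of length at most `k` from `u` to `v` is
fixed pointwise by `rep^[2 * n]`. -/
theorem exists_walk_fixed {d k : ℕ} (M : AlmostMooreDigraph d k) {n : ℕ} {u v : M.V}
    (hu : M.rep^[n] u = u) (hv : M.rep^[n] v = v) :
    ∃ l : List M.V, IsWalkFrom M.Adj u v l ∧ l.length ≤ k ∧
      ∀ w ∈ l, M.rep^[2 * n] w = w := by
  have hmap : ∀ l, IsWalkFrom M.Adj u v l → IsWalkFrom M.Adj u v (l.map M.rep^[n]) := by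
    intro l hl
    simpa only [hu, hv] using hl.map (iterate_rep_adj M n)
  have hfix : ∀ l : List M.V, (l.map M.rep^[n]).map M.rep^[n] = l →
      ∀ w ∈ l, M.rep^[2 * n] w = w := by
    intro l hl w hw
    rw [List.map_map] at hl
    rw [two_mul, Function.iterate_add]
    exact List.map_inj_left.1 (hl.trans (List.map_id l).symm) w hw
  by_cases hrep : v = M.rep u
  · subst hrep
    obtain ⟨l₁, l₂, hne, hw₁, hk₁, hw₂, hk₂, -, honly⟩ := M.rep_two u
    refine ⟨l₁, hw₁, hk₁, hfix l₁ ?_⟩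
    have hinj : Function.Injective (List.map M.rep^[n]) :=
      List.map_injective_iff.2 (M.rep_bijective.injective.iterate n)
    rcases honly _ (hmap l₁ hw₁) (by simpa using hk₁) with h₁ | h₁
    · rw [h₁, h₁]
    · rcases honly _ (hmap l₂ hw₂) (by simpa using hk₂) with h₂ | h₂
      · rw [h₁, h₂]
      · exact absurd (hinj (h₁.trans h₂.symm)) hne
  · obtain ⟨l, ⟨hw, hk⟩, huniq⟩ := M.rep_spec u v hrep
    have hl : l.map M.rep^[n] = l := huniq _ ⟨hmap l hw, by simpa using hk⟩
    exact ⟨l, hw, hk, hfix l (by rw [hl, hl])⟩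

/-- The subdigraph `H_α` has diameter at most `k`: for any two vertices
`u, v` of `H_α` there is a directed walk of length at most `k` from `u` to `v` using only
vertices of `H_α`. -/
theorem stmt6 {d k : ℕ} (M : AlmostMooreDigraph d k) (α : ℕ) (hα : 1 < α) :
    ∀ u ∈ Hset M α, ∀ v ∈ Hset M α,
      ∃ l : List M.V, IsWalkFrom M.Adj u v l ∧ l.length ≤ k ∧
        ∀ w ∈ u :: l, w ∈ Hset M α := by
  intro u hu v hv
  obtain ⟨s, hs⟩ := (mem_Hset_iff M α u).1 hu
  obtain ⟨t, ht⟩ := (mem_Hset_iff M α v).1 hv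
  have hu' : M.rep^[2 ^ (s + t) * α] u = u :=
    Function.IsPeriodicPt.trans_dvd hs ⟨2 ^ t, by ring⟩
  have hv' : M.rep^[2 ^ (s + t) * α] v = v :=
    Function.IsPeriodicPt.trans_dvd ht ⟨2 ^ s, by ring⟩
  obtain ⟨l, hw, hk, hfix⟩ := exists_walk_fixed M hu' hv'
  refine ⟨l, hw, hk, List.forall_mem_cons.2 ⟨hu, fun w hwl => ?_⟩⟩
  refine (mem_Hset_iff M α w).2 ⟨s + t + 1, ?_⟩
  rw [pow_succ', mul_assoc]
  exact hfix w hwl
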